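/- Let A ∈ ℝ^{n×d} and x ∈ ℝ^d be fixed with A having linearly independent columns, and suppose d + 2 < n. If b₁,…,bₙ, a₁ are i.i.d. standard Gaussian N(0,1) random variables and b = (b₁,…,bₙ)ᵀ, then E_{b,a₁} ‖[Aᵀ; bᵀ]⁺ [x; a₁]‖² ≤ ((n−2)‖(A⁺)ᵀx‖² + 1)/(n − d − 2). -/

import Mathlib

open MeasureTheory ProbabilityTheory Matrix
open scoped NNReal ENNReal

noncomputable section

/-- Squared Euclidean norm of a vector in `ℝ^n`. -/
def sqnorm {n : ℕ} (v : Fin n → ℝ) : ℝ := ∑ i, v i ^ 2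

/-- Moore–Penrose pseudoinverse of a matrix with linearly independent rows:
`M⁺ = Mᵀ (M Mᵀ)⁻¹`. -/
def pinvRows {m n : ℕ} (M : Matrix (Fin m) (Fin n) ℝ) : Matrix (Fin n) (Fin m) ℝ :=
  Mᵀ * (M * Mᵀ)⁻¹

/-- Moore–Penrose pseudoinverse of a matrix with linearly independent columns:
`M⁺ = (Mᵀ M)⁻¹ Mᵀ`. -/
def pinvCols {m n : ℕ} (M : Matrix (Fin m) (Fin n) ℝ) : Matrix (Fin n) (Fin m) ℝ :=
  (Mᵀ * M)⁻¹ * Mᵀ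

/-- Append a row at the bottom of a matrix. -/
def appendRow {m n : ℕ} (M : Matrix (Fin m) (Fin n) ℝ) (r : Fin n → ℝ) :
    Matrix (Fin (m + 1)) (Fin n) ℝ := Matrix.of (Fin.snoc (fun i => M i) r)

lemma lintegral_exp_neg_mul_Ioi {r : ℝ} (hr : 0 ≤ r) :
    ∫⁻ s in Set.Ioi (0 : ℝ), ENNReal.ofReal (Real.exp (-(s * r))) = (ENNReal.ofReal r)⁻¹ := by
  rcases hr.eq_or_lt with rfl | hr
  · simp
  · have hcomm : ∀ s : ℝ, -(s * r) = -r * s := fun s => by ring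
    simp_rw [hcomm]
    rw [← ofReal_integral_eq_lintegral_ofReal (integrableOn_exp_mul_Ioi (by linarith) 0)
      (ae_of_all _ fun s => (Real.exp_pos _).le), integral_exp_mul_Ioi (by linarith) 0,
      ← ENNReal.ofReal_inv_of_pos hr]
    simp

lemma lintegral_exp_neg_mul_sq_gaussianReal {s : ℝ} (hs : 0 ≤ s) :
    ∫⁻ x, ENNReal.ofReal (Real.exp (-(s * x ^ 2))) ∂(gaussianReal 0 1)
      = ENNReal.ofReal ((1 + 2 * s) ^ (-(1 / 2) : ℝ)) := by
  rw [← ofReal_integral_eq_lintegral_ofReal _ (ae_of_all _ fun s => (Real.exp_pos _).le)]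
  · congr 1
    rw [integral_gaussianReal_eq_integral_smul one_ne_zero]
    have key : ∀ x : ℝ, gaussianPDFReal 0 1 x • Real.exp (-(s * x ^ 2))
        = (√(2 * Real.pi))⁻¹ * Real.exp (-(s + 1 / 2) * x ^ 2) := by
      intro x
      simp only [gaussianPDFReal, smul_eq_mul, mul_assoc, ← Real.exp_add, NNReal.coe_one]
      congr 2
      · simp
      · ring_nf
    simp_rw [key]
    rw [integral_const_mul, integral_gaussian, ← Real.sqrt_inv, ← Real.sqrt_mul (by positivity),
      Real.rpow_neg (by positivity), ← Real.sqrt_eq_rpow, ← Real.sqrt_inv]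
    congr 1
    have : s + 1 / 2 ≠ 0 := by positivity
    have : 1 + 2 * s ≠ 0 := by positivity
    have := Real.pi_ne_zero
    field_simp
    ring
  · refine Integrable.of_bound (by fun_prop) 1 (ae_of_all _ fun x => ?_)
    rw [Real.norm_of_nonneg (Real.exp_pos _).le, Real.exp_le_one_iff]
    have := mul_nonneg hs (sq_nonneg x)
    linarith

lemma lintegral_one_add_two_mul_rpow {p : ℝ} (hp : 2 < p) :
    ∫⁻ s in Set.Ioi (0 : ℝ), ENNReal.ofReal ((1 + 2 * s) ^ (-(p / 2)))
      = ENNReal.ofReal (1 / (p - 2)) := by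
  have hderiv : ∀ s ∈ Set.Ici (0 : ℝ),
      HasDerivAt (fun s : ℝ => -(1 / (p - 2)) * (1 + 2 * s) ^ (-(p / 2 - 1)))
        ((1 + 2 * s) ^ (-(p / 2))) s := by
    intro s hs
    have hs : 0 ≤ s := hs
    have h1 : HasDerivAt (fun s : ℝ => 1 + 2 * s) 2 s := by
      simpa using ((hasDerivAt_id s).const_mul 2).const_add 1
    have h2 := (h1.rpow_const (p := -(p / 2 - 1)) (Or.inl (by positivity))).const_mul
      (-(1 / (p - 2)))
    refine h2.congr_deriv ?_
    rw [show -(p / 2 - 1) - 1 = -(p / 2) by ring]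
    have : p - 2 ≠ 0 := by linarith
    field_simp
  have hpos : ∀ s ∈ Set.Ioi (0 : ℝ), 0 ≤ (1 + 2 * s) ^ (-(p / 2)) := fun s hs => by
    have hs : 0 < s := hs
    positivity
  have hlim : Filter.Tendsto (fun s : ℝ => -(1 / (p - 2)) * (1 + 2 * s) ^ (-(p / 2 - 1)))
      Filter.atTop (nhds 0) := by
    have h1 : Filter.Tendsto (fun s : ℝ => 1 + 2 * s) Filter.atTop Filter.atTop :=
      Filter.tendsto_atTop_add_const_left _ _
        (Filter.tendsto_id.const_mul_atTop (by norm_num : (0 : ℝ) < 2))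
    simpa using ((tendsto_rpow_neg_atTop (by linarith : 0 < p / 2 - 1)).comp h1).const_mul
      (-(1 / (p - 2)))
  rw [← ofReal_integral_eq_lintegral_ofReal (integrableOn_Ioi_deriv_of_nonneg' hderiv hpos hlim)
    ((ae_restrict_iff' measurableSet_Ioi).2 (ae_of_all _ hpos)),
    integral_Ioi_of_hasDerivAt_of_nonneg' hderiv hpos hlim]
  simp

/-- The expectation of the reciprocal of a chi-squared variable with `k > 2` degrees of freedom. -/
lemma lintegral_inv_sum_sq_pi_gaussianReal {k : ℕ} (hk : 2 < k) :
    ∫⁻ g : Fin k → ℝ, (ENNReal.ofReal (∑ j, g j ^ 2))⁻¹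
        ∂(Measure.pi fun _ : Fin k => gaussianReal 0 1)
      = ENNReal.ofReal (1 / ((k : ℝ) - 2)) := by
  have hnn : ∀ g : Fin k → ℝ, 0 ≤ ∑ j, g j ^ 2 := fun g => by positivity
  simp_rw [← lintegral_exp_neg_mul_Ioi (hnn _)]
  rw [lintegral_lintegral_swap (by fun_prop),
    ← lintegral_one_add_two_mul_rpow (by exact_mod_cast hk : (2 : ℝ) < k)]
  refine setLIntegral_congr_fun measurableSet_Ioi fun s hs => ?_
  have hs : 0 ≤ s := le_of_lt hs
  have hprod : ∀ g : Fin k → ℝ, ENNReal.ofReal (Real.exp (-(s * ∑ j, g j ^ 2)))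
      = ∏ j, ENNReal.ofReal (Real.exp (-(s * g j ^ 2))) := fun g => by
    rw [← ENNReal.ofReal_prod_of_nonneg fun _ _ => (Real.exp_pos _).le, ← Real.exp_sum,
      Finset.mul_sum, Finset.sum_neg_distrib]
  have hind : iIndepFun (fun (j : Fin k) (g : Fin k → ℝ) =>
      ENNReal.ofReal (Real.exp (-(s * g j ^ 2)))) (Measure.pi fun _ : Fin k => gaussianReal 0 1) :=
    iIndepFun_pi (X := fun _ x => ENNReal.ofReal (Real.exp (-(s * x ^ 2)))) fun j => by fun_prop
  simp_rw [hprod]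
  rw [lintegral_prod_eq_prod_lintegral_of_indepFun _ _ hind fun j => by fun_prop]
  have hmarg : ∀ j : Fin k, ∫⁻ g : Fin k → ℝ, ENNReal.ofReal (Real.exp (-(s * g j ^ 2)))
      ∂(Measure.pi fun _ : Fin k => gaussianReal 0 1)
      = ENNReal.ofReal ((1 + 2 * s) ^ (-(1 / 2) : ℝ)) := fun j => by
    rw [← lintegral_exp_neg_mul_sq_gaussianReal hs]
    exact (measurePreserving_eval (fun _ : Fin k => gaussianReal 0 1) j).lintegral_comp
      (f := fun x => ENNReal.ofReal (Real.exp (-(s * x ^ 2)))) (by fun_prop)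
  simp_rw [hmarg]
  rw [Finset.prod_const, Finset.card_univ, Fintype.card_fin, ← ENNReal.ofReal_pow (by positivity),
    ← Real.rpow_natCast, ← Real.rpow_mul (by positivity)]
  congr 2
  ring

lemma lintegral_sub_sq_gaussianReal (t : ℝ) :
    ∫⁻ a, ENNReal.ofReal ((a - t) ^ 2) ∂(gaussianReal 0 1) = ENNReal.ofReal (1 + t ^ 2) := by
  have h1 : MemLp (fun x : ℝ => x) 2 (gaussianReal 0 1) := memLp_id_gaussianReal 2
  have h2 : Integrable (fun x : ℝ => x ^ 2) (gaussianReal 0 1) := h1.integrable_sq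
  have h3 : Integrable (fun x : ℝ => x) (gaussianReal 0 1) := h1.integrable (by norm_num)
  have hsq : ∫ x, x ^ 2 ∂(gaussianReal 0 1) = 1 := by
    have := variance_of_integral_eq_zero (μ := gaussianReal 0 1) (X := fun x => x)
      (by fun_prop) (by simp)
    simpa using this.symm
  have h4 : Integrable (fun x : ℝ => (x - t) ^ 2) (gaussianReal 0 1) :=
    (h1.sub (memLp_const t)).integrable_sq
  rw [← ofReal_integral_eq_lintegral_ofReal h4
    (ae_of_all _ fun _ => sq_nonneg _)]
  congr 1
  have : ∀ a : ℝ, (a - t) ^ 2 = a ^ 2 - 2 * t * a + t ^ 2 := fun a => by ring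
  simp_rw [this]
  have h5 : Integrable (fun x : ℝ => x ^ 2 - 2 * t * x) (gaussianReal 0 1) :=
    h2.sub (h3.const_mul _)
  rw [integral_add h5 (integrable_const _), integral_sub h2 (h3.const_mul _), integral_const_mul, hsq]
  simp

lemma lintegral_one_add_sq_pi_gaussianReal {ι : Type*} [Fintype ι] (c : ι → ℝ) :
    ∫⁻ g : ι → ℝ, ENNReal.ofReal (1 + (∑ i, c i * g i) ^ 2)
        ∂(Measure.pi fun _ : ι => gaussianReal 0 1)
      = ENNReal.ofReal (1 + ∑ i, c i ^ 2) := by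
  set μ := Measure.pi fun _ : ι => gaussianReal 0 1
  have hc : ∀ i, MemLp (fun x : ℝ => c i * x) 2 (gaussianReal 0 1) := fun i =>
    (memLp_id_gaussianReal 2).const_mul (c i)
  have hci : ∀ i, MemLp (fun g : ι → ℝ => c i * g i) 2 μ := fun i =>
    (hc i).comp_measurePreserving (measurePreserving_eval (fun _ : ι => gaussianReal 0 1) i)
  have hs : MemLp (fun g : ι → ℝ => ∑ i, c i * g i) 2 μ := memLp_finsetSum _ fun i _ => hci i
  have hmean : ∫ g : ι → ℝ, ∑ i, c i * g i ∂μ = 0 := by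
    rw [integral_finsetSum _ fun i _ => (hci i).integrable (by norm_num)]
    refine Finset.sum_eq_zero fun i _ => ?_
    rw [integral_const_mul, integral_comp_eval (i := i) (X := fun _ : ι => ℝ)
      (μ := fun _ : ι => gaussianReal 0 1) (f := fun x => x) (by fun_prop)]
    simp
  have hvar : ∫ g : ι → ℝ, (∑ i, c i * g i) ^ 2 ∂μ = ∑ i, c i ^ 2 := by
    rw [← variance_of_integral_eq_zero hs.aestronglyMeasurable.aemeasurable hmean]
    have h : Var[∑ i, fun g : ι → ℝ => c i * g i; μ]
        = ∑ i, Var[fun x => c i * x; gaussianReal 0 1] := variance_sum_pi hc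
    have hi : ∀ i, Var[fun x => c i * x; gaussianReal 0 1] = c i ^ 2 := fun i => by
      rw [variance_const_mul (c i) (fun x => x), variance_fun_id_gaussianReal, NNReal.coe_one,
        mul_one]
    simp_rw [hi] at h
    rw [← h]
    congr 1
    ext g
    rw [Finset.sum_apply]
  have hF : Integrable (fun g : ι → ℝ => 1 + (∑ i, c i * g i) ^ 2) μ :=
    (integrable_const _).add hs.integrable_sq
  rw [← ofReal_integral_eq_lintegral_ofReal hF
    (ae_of_all _ fun _ => by positivity), integral_add (integrable_const _) hs.integrable_sq, hvar]
  simp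

lemma sqnorm_eq_dotProduct {n : ℕ} (v : Fin n → ℝ) : sqnorm v = v ⬝ᵥ v := by
  simp [sqnorm, dotProduct, sq]

lemma sqnorm_nonneg {n : ℕ} (v : Fin n → ℝ) : 0 ≤ sqnorm v :=
  Finset.sum_nonneg fun _ _ => sq_nonneg _

/-- `pinvRows M *ᵥ (M *ᵥ w)` has at most the norm of `w`, for every matrix `M`. -/
lemma sqnorm_pinvRows_mulVec_le {m n : ℕ} (M : Matrix (Fin m) (Fin n) ℝ) (w : Fin n → ℝ) :
    sqnorm (pinvRows M *ᵥ (M *ᵥ w)) ≤ sqnorm w := by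
  by_cases h : IsUnit (M * Mᵀ).det
  · set u := (M * Mᵀ)⁻¹ *ᵥ (M *ᵥ w) with hu
    have hz : pinvRows M *ᵥ (M *ᵥ w) = Mᵀ *ᵥ u := by
      rw [pinvRows, hu, ← mulVec_mulVec]
    have hMz : M *ᵥ (Mᵀ *ᵥ u) = M *ᵥ w := by
      rw [hu, mulVec_mulVec, mulVec_mulVec, mul_nonsing_inv _ h, one_mulVec]
    have key : (Mᵀ *ᵥ u) ⬝ᵥ (Mᵀ *ᵥ u) = (Mᵀ *ᵥ u) ⬝ᵥ w := by
      rw [mulVec_transpose, ← dotProduct_mulVec, ← dotProduct_mulVec, ← mulVec_transpose, hMz]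
    have hnn := sqnorm_nonneg (w - Mᵀ *ᵥ u)
    rw [sqnorm_eq_dotProduct, sub_dotProduct, dotProduct_sub, dotProduct_sub, key,
      dotProduct_comm w (Mᵀ *ᵥ u)] at hnn
    rw [hz, sqnorm_eq_dotProduct, sqnorm_eq_dotProduct, key]
    linarith
  · have : pinvRows M *ᵥ (M *ᵥ w) = 0 := by
      simp [pinvRows, nonsing_inv_apply_not_isUnit _ h]
    rw [this]
    simpa [sqnorm_eq_dotProduct] using sqnorm_nonneg w

lemma appendRow_mulVec {m n : ℕ} (M : Matrix (Fin m) (Fin n) ℝ) (r w : Fin n → ℝ) :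
    appendRow M r *ᵥ w = Fin.snoc (M *ᵥ w) (r ⬝ᵥ w) := by
  ext i
  refine Fin.lastCases ?_ (fun i => ?_) i <;> simp [appendRow, mulVec]

lemma sqnorm_pinvRows_appendRow_le {m n : ℕ} (M : Matrix (Fin m) (Fin n) ℝ)
    (b w q : Fin n → ℝ) (a : ℝ) (hq : M *ᵥ q = 0) (hwq : w ⬝ᵥ q = 0)
    (hbq : b ⬝ᵥ q = sqnorm q) (hq0 : sqnorm q ≠ 0) :
    sqnorm (pinvRows (appendRow M b) *ᵥ Fin.snoc (M *ᵥ w) a)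
      ≤ sqnorm w + (a - b ⬝ᵥ w) ^ 2 * (sqnorm q)⁻¹ := by
  set t := (a - b ⬝ᵥ w) * (sqnorm q)⁻¹ with ht
  have h1 : appendRow M b *ᵥ (w + t • q) = Fin.snoc (M *ᵥ w) a := by
    rw [appendRow_mulVec, mulVec_add, mulVec_smul, hq, dotProduct_add, dotProduct_smul, hbq, ht,
      smul_eq_mul, inv_mul_cancel_right₀ hq0]
    simp
  have h2 : sqnorm (w + t • q) = sqnorm w + (a - b ⬝ᵥ w) ^ 2 * (sqnorm q)⁻¹ := by
    have : sqnorm (w + t • q) = sqnorm w + t ^ 2 * sqnorm q := by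
      simp only [sqnorm_eq_dotProduct, add_dotProduct, dotProduct_add, smul_dotProduct,
        dotProduct_smul, dotProduct_comm q w, hwq, smul_eq_mul]
      ring
    rw [this, ht]
    field_simp
  rw [← h1, ← h2]
  exact sqnorm_pinvRows_mulVec_le _ _

lemma isUnit_det_transpose_mul_self {n d : ℕ} {A : Matrix (Fin n) (Fin d) ℝ}
    (hA : LinearIndependent ℝ (fun j => Aᵀ j)) : IsUnit (Aᵀ * A).det := by
  have h := PosDef.conjTranspose_mul_self A (mulVec_injective_iff.2 hA)
  simpa using h.det_pos.ne'

lemma transpose_mulVec_pinvCols {n d : ℕ} {A : Matrix (Fin n) (Fin d) ℝ}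
    (hA : LinearIndependent ℝ (fun j => Aᵀ j)) (x : Fin d → ℝ) :
    Aᵀ *ᵥ ((pinvCols A)ᵀ *ᵥ x) = x := by
  have h := isUnit_det_transpose_mul_self hA
  rw [pinvCols, transpose_mul, transpose_transpose, transpose_nonsing_inv, transpose_mul,
    transpose_transpose, mulVec_mulVec, ← Matrix.mul_assoc, mul_nonsing_inv _ h, one_mulVec]

lemma pinvCols_transpose_mulVec_dotProduct {n d : ℕ} {A : Matrix (Fin n) (Fin d) ℝ}
    (x : Fin d → ℝ) {q : Fin n → ℝ} (hq : Aᵀ *ᵥ q = 0) :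
    ((pinvCols A)ᵀ *ᵥ x) ⬝ᵥ q = 0 := by
  rw [mulVec_transpose, ← dotProduct_mulVec, pinvCols, ← mulVec_mulVec, hq]
  simp

/-- The orthogonal complement of the column space has an orthonormal basis of size `n - d`,
which extends to an orthonormal basis of the whole space. -/
lemma exists_orthonormalBasis_ker_transpose {n d : ℕ} {A : Matrix (Fin n) (Fin d) ℝ}
    (hA : LinearIndependent ℝ (fun j => Aᵀ j)) :
    ∃ v : OrthonormalBasis (Fin d ⊕ Fin (n - d)) ℝ (EuclideanSpace ℝ (Fin n)),
      ∀ j, Aᵀ *ᵥ (v (Sum.inr j)).ofLp = 0 := by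
  let c : Fin d → EuclideanSpace ℝ (Fin n) := fun j => WithLp.toLp 2 (Aᵀ j)
  have hc : LinearIndependent ℝ c :=
    hA.map' (WithLp.linearEquiv 2 ℝ (Fin n → ℝ)).symm.toLinearMap (LinearEquiv.ker _)
  let K := Submodule.span ℝ (Set.range c)
  have hK : Module.finrank ℝ K = d := by simpa using finrank_span_eq_card hc
  have hKo : Module.finrank ℝ Kᗮ = n - d := by
    have := K.finrank_add_finrank_orthogonal
    rw [finrank_euclideanSpace_fin] at this
    omega
  have hdn : d ≤ n := by
    have := K.finrank_le
    rw [finrank_euclideanSpace_fin] at this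
    omega
  let u := (stdOrthonormalBasis ℝ Kᗮ).reindex (finCongr hKo)
  let f : Fin d ⊕ Fin (n - d) → EuclideanSpace ℝ (Fin n) := Sum.elim 0 fun j => (u j : _)
  have hu : Orthonormal ℝ fun j => (u j : EuclideanSpace ℝ (Fin n)) :=
    u.orthonormal.comp_linearIsometry Kᗮ.subtypeₗᵢ
  have hf : Orthonormal ℝ ((Set.range Sum.inr).domRestrict f) := by
    rw [orthonormal_iff_ite] at hu ⊢
    rintro ⟨_, i, rfl⟩ ⟨_, j, rfl⟩
    simpa [f, Set.domRestrict, Subtype.ext_iff] using hu i j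
  obtain ⟨v, hv⟩ := hf.exists_orthonormalBasis_extension_of_card_eq
    (by simp; omega)
  refine ⟨v, fun j => ?_⟩
  rw [hv _ ⟨j, rfl⟩]
  ext i
  have := Submodule.inner_right_of_mem_orthogonal
    (Submodule.subset_span (Set.mem_range_self i) : c i ∈ K) (u j).2
  rw [EuclideanSpace.inner_eq_star_dotProduct, dotProduct_comm] at this
  exact this

lemma lintegral_pi_gaussianReal_orthonormalBasis {n : ℕ} {ι : Type*} [Fintype ι]
    (v : OrthonormalBasis ι ℝ (EuclideanSpace ℝ (Fin n))) {f : (ι → ℝ) → ℝ≥0∞}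
    (hf : Measurable f) :
    ∫⁻ b, f (fun i => b ⬝ᵥ (v i).ofLp) ∂(Measure.pi fun _ : Fin n => gaussianReal 0 1)
      = ∫⁻ g, f g ∂(Measure.pi fun _ : ι => gaussianReal 0 1) := by
  let F : EuclideanSpace ℝ (Fin n) → ℝ≥0∞ := fun y => f fun i => inner ℝ (v i) y
  have hF : Measurable F := hf.comp (by fun_prop)
  calc _ = ∫⁻ y, F y ∂(stdGaussian (EuclideanSpace ℝ (Fin n))) := by
        rw [← map_pi_eq_stdGaussian, lintegral_map hF (by fun_prop)]
        simp [F, EuclideanSpace.inner_eq_star_dotProduct]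
    _ = _ := by
        rw [stdGaussian_eq_map_pi_orthonormalBasis v, lintegral_map hF (by fun_prop)]
        refine lintegral_congr fun g => ?_
        simp only [F]
        congr 1
        ext i
        exact v.orthonormal.inner_right_fintype g i

lemma lintegral_pi_gaussianReal_mul {n d k : ℕ}
    (v : OrthonormalBasis (Fin d ⊕ Fin k) ℝ (EuclideanSpace ℝ (Fin n)))
    {f : (Fin d → ℝ) → ℝ≥0∞} {h : (Fin k → ℝ) → ℝ≥0∞} (hf : Measurable f) (hh : Measurable h) :
    ∫⁻ b, f (fun i => b ⬝ᵥ (v (Sum.inl i)).ofLp) * h (fun j => b ⬝ᵥ (v (Sum.inr j)).ofLp)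
        ∂(Measure.pi fun _ : Fin n => gaussianReal 0 1)
      = (∫⁻ g, f g ∂(Measure.pi fun _ : Fin d => gaussianReal 0 1))
        * ∫⁻ g, h g ∂(Measure.pi fun _ : Fin k => gaussianReal 0 1) := by
  have h1 := lintegral_pi_gaussianReal_orthonormalBasis v
    (f := fun g => f (fun i => g (Sum.inl i)) * h fun j => g (Sum.inr j))
    ((hf.comp (by fun_prop)).mul (hh.comp (by fun_prop)))
  rw [h1, ← lintegral_prod_mul hf.aemeasurable hh.aemeasurable]
  exact (measurePreserving_sumPiEquivProdPi
    (fun _ : Fin d ⊕ Fin k => gaussianReal 0 1)).lintegral_comp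
    (f := fun p : (Fin d → ℝ) × (Fin k → ℝ) => f p.1 * h p.2)
    ((hf.comp measurable_fst).mul (hh.comp measurable_snd))

lemma dotProduct_eq_sum_orthonormalBasis {n : ℕ} {ι : Type*} [Fintype ι]
    (v : OrthonormalBasis ι ℝ (EuclideanSpace ℝ (Fin n))) (a b : Fin n → ℝ) :
    a ⬝ᵥ b = ∑ i, (a ⬝ᵥ (v i).ofLp) * (b ⬝ᵥ (v i).ofLp) := by
  have h := v.sum_inner_mul_inner (WithLp.toLp 2 b) (WithLp.toLp 2 a)
  simp only [EuclideanSpace.inner_eq_star_dotProduct, star_trivial] at h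
  rw [← h]
  exact Finset.sum_congr rfl fun i _ => by rw [mul_comm, dotProduct_comm (v i).ofLp b]

lemma orthonormalBasis_dotProduct {n : ℕ} {ι : Type*} [Fintype ι] [DecidableEq ι]
    (v : OrthonormalBasis ι ℝ (EuclideanSpace ℝ (Fin n))) (i j : ι) :
    (v i).ofLp ⬝ᵥ (v j).ofLp = if i = j then 1 else 0 := by
  have h := orthonormal_iff_ite.1 v.orthonormal i j
  rwa [EuclideanSpace.inner_eq_star_dotProduct, star_trivial, dotProduct_comm] at h

/-- expectation bound when the new feature entries `b₁,…,bₙ,a₁` are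
i.i.d. standard Gaussian (second part of Theorem 3 of the paper). -/
theorem stmt6 (n d : ℕ) (hdn : d + 2 < n)
    (A : Matrix (Fin n) (Fin d) ℝ) (x : Fin d → ℝ)
    (hAli : LinearIndependent ℝ (fun j => Aᵀ j)) :
    (∫ p : (Fin n → ℝ) × ℝ,
        sqnorm (pinvRows (appendRow Aᵀ p.1) *ᵥ Fin.snoc x p.2)
        ∂(Measure.pi fun _ : Fin n => gaussianReal 0 1).prod (gaussianReal 0 1))
      ≤ (((n : ℝ) - 2) * sqnorm ((pinvCols A)ᵀ *ᵥ x) + 1) / ((n : ℝ) - d - 2) := by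
  obtain ⟨v, hv⟩ := exists_orthonormalBasis_ker_transpose hAli
  set w := (pinvCols A)ᵀ *ᵥ x
  have hAw : Aᵀ *ᵥ w = x := transpose_mulVec_pinvCols hAli x
  have hwv : ∀ j, w ⬝ᵥ (v (Sum.inr j)).ofLp = 0 := fun j =>
    pinvCols_transpose_mulVec_dotProduct x (hv j)
  let c : Fin d → ℝ := fun i => w ⬝ᵥ (v (Sum.inl i)).ofLp
  have hbw : ∀ b : Fin n → ℝ, b ⬝ᵥ w = ∑ i, c i * (b ⬝ᵥ (v (Sum.inl i)).ofLp) := fun b => by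
    rw [dotProduct_eq_sum_orthonormalBasis v b w, Fintype.sum_sum_type]
    simp [hwv, c, mul_comm]
  have hww : sqnorm w = ∑ i, c i ^ 2 := by
    rw [sqnorm_eq_dotProduct, hbw]
    simp [c, sq]
  let μ := Measure.pi fun _ : Fin n => gaussianReal 0 1
  let S : (Fin n → ℝ) → ℝ := fun b => ∑ j, (b ⬝ᵥ (v (Sum.inr j)).ofLp) ^ 2
  have hSm : Measurable S := by
    simp only [S, dotProduct]
    fun_prop
  have hbwm : Measurable fun b : Fin n → ℝ => b ⬝ᵥ w := by
    simp only [dotProduct]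
    fun_prop
  have hk : 2 < n - d := by omega
  have hkR : ((n - d : ℕ) : ℝ) - 2 = n - d - 2 := by rw [Nat.cast_sub (by omega)]
  have hpos : 0 < (n : ℝ) - d - 2 := by
    have : (d : ℝ) + 2 < n := by exact_mod_cast hdn
    linarith
  have hSae : ∀ᵐ b ∂μ, S b ≠ 0 := by
    have hlt : ∫⁻ b, (ENNReal.ofReal (S b))⁻¹ ∂μ ≠ ∞ := by
      have h := lintegral_pi_gaussianReal_mul v (f := fun _ => 1)
        (h := fun g => (ENNReal.ofReal (∑ j, g j ^ 2))⁻¹) (by fun_prop) (by fun_prop)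
      rw [lintegral_inv_sum_sq_pi_gaussianReal hk] at h
      simp only [one_mul, lintegral_const, measure_univ] at h
      rw [h]
      exact ENNReal.ofReal_ne_top
    filter_upwards [ae_lt_top (by fun_prop) hlt] with b hb hS
    simp [hS] at hb
  have hbound : ∀ b a, S b ≠ 0 → sqnorm (pinvRows (appendRow Aᵀ b) *ᵥ Fin.snoc x a)
      ≤ sqnorm w + (a - b ⬝ᵥ w) ^ 2 * (S b)⁻¹ := by
    intro b a hS
    set q : Fin n → ℝ := ∑ j, (b ⬝ᵥ (v (Sum.inr j)).ofLp) • (v (Sum.inr j)).ofLp with hq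
    have hqS : b ⬝ᵥ q = S b := by
      simp [hq, S, dotProduct_sum, sq]
    have hqq : sqnorm q = S b := by
      rw [sqnorm_eq_dotProduct, dotProduct_eq_sum_orthonormalBasis v q q, Fintype.sum_sum_type]
      simp [hq, S, sum_dotProduct, orthonormalBasis_dotProduct, sq]
    have hAq : Aᵀ *ᵥ q = 0 := by
      simp [hq, mulVec_sum, mulVec_smul, hv]
    have hwq : w ⬝ᵥ q = 0 := by
      simp [hq, dotProduct_sum, hwv]
    rw [← hqq, ← hAw]
    exact sqnorm_pinvRows_appendRow_le Aᵀ b w q a hAq hwq (hqS.trans hqq.symm) (hqq ▸ hS)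
  have hlin : ∫⁻ p : (Fin n → ℝ) × ℝ,
      ENNReal.ofReal (sqnorm (pinvRows (appendRow Aᵀ p.1) *ᵥ Fin.snoc x p.2))
        ∂μ.prod (gaussianReal 0 1)
      ≤ ENNReal.ofReal (sqnorm w + (1 + sqnorm w) * (1 / ((n : ℝ) - d - 2))) := by
    calc _ ≤ ∫⁻ p : (Fin n → ℝ) × ℝ, (ENNReal.ofReal (sqnorm w)
          + ENNReal.ofReal ((p.2 - p.1 ⬝ᵥ w) ^ 2) * (ENNReal.ofReal (S p.1))⁻¹)
          ∂μ.prod (gaussianReal 0 1) := by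
          refine lintegral_mono_ae ?_
          filter_upwards [Measure.quasiMeasurePreserving_fst.ae hSae] with p hp
          have hSp : 0 < S p.1 :=
            lt_of_le_of_ne (Finset.sum_nonneg fun _ _ => sq_nonneg _) (Ne.symm hp)
          rw [← ENNReal.ofReal_inv_of_pos hSp, ← ENNReal.ofReal_mul (sq_nonneg _),
            ← ENNReal.ofReal_add (sqnorm_nonneg w) (by positivity)]
          exact ENNReal.ofReal_le_ofReal (hbound _ _ hp)
      _ = ENNReal.ofReal (sqnorm w)
          + ∫⁻ b, ENNReal.ofReal (1 + (b ⬝ᵥ w) ^ 2) * (ENNReal.ofReal (S b))⁻¹ ∂μ := by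
          rw [lintegral_add_left measurable_const, lintegral_const, measure_univ, mul_one,
            lintegral_prod _ (by fun_prop)]
          congr 1
          refine lintegral_congr fun b => ?_
          dsimp only
          rw [lintegral_mul_const _ (by fun_prop), lintegral_sub_sq_gaussianReal]
      _ = ENNReal.ofReal (sqnorm w)
          + ENNReal.ofReal (1 + sqnorm w) * ENNReal.ofReal (1 / ((n : ℝ) - d - 2)) := by
          rw [← hkR, ← lintegral_inv_sum_sq_pi_gaussianReal hk, hww,
            ← lintegral_one_add_sq_pi_gaussianReal c, ← lintegral_pi_gaussianReal_mul v
              (f := fun g => ENNReal.ofReal (1 + (∑ i, c i * g i) ^ 2))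
              (h := fun g => (ENNReal.ofReal (∑ j, g j ^ 2))⁻¹) (by fun_prop) (by fun_prop)]
          simp_rw [hbw]
          rfl
      _ = _ := by
          have := sqnorm_nonneg w
          rw [← ENNReal.ofReal_mul (by positivity), ← ENNReal.ofReal_add this (by positivity)]
  have hfinal : sqnorm w + (1 + sqnorm w) * (1 / ((n : ℝ) - d - 2))
      ≤ (((n : ℝ) - 2) * sqnorm w + 1) / ((n : ℝ) - d - 2) := by
    rw [le_div_iff₀ hpos, add_mul, mul_assoc, one_div_mul_cancel hpos.ne']
    rcases Nat.eq_zero_or_pos d with rfl | hd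
    · have : sqnorm w = 0 := by simp [hww]
      simp [this]
    · have hd : (1 : ℝ) ≤ d := by exact_mod_cast hd
      nlinarith [sqnorm_nonneg w]
  refine le_trans ?_ hfinal
  have hw0 := sqnorm_nonneg w
  by_cases hF : Integrable (fun p : (Fin n → ℝ) × ℝ =>
      sqnorm (pinvRows (appendRow Aᵀ p.1) *ᵥ Fin.snoc x p.2)) (μ.prod (gaussianReal 0 1))
  · rw [integral_eq_lintegral_of_nonneg_ae (ae_of_all _ fun _ => sqnorm_nonneg _)
      hF.aestronglyMeasurable]
    exact ENNReal.toReal_le_of_le_ofReal (by positivity) hlin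
  · rw [integral_undef hF]
    positivity

end
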